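/- arXiv:2501.16506 — 2 statements merged into one kernel-verified Lean document; each statement's English description precedes it below -/
import Mathlib

section
/- The function h(s) = s²·Φ(−s)/(1 − 2·Φ(−s)) attains its maximum over (0,∞) at a unique point s**, and this point satisfies 0.864 < s** < 0.865; moreover 0.386 < 2·Φ(−s**) < 0.388, and the corresponding optimal non-reversible efficiency satisfies 1.88 < 8·(s**)²·Φ(−s**)/(1 − 2·Φ(−s**)) < 1.90. -/
/-- The standard normal cumulative distribution function
Phi(z) = int_{-infty}^z (1/sqrt(2 pi)) exp(-u^2/2) du. -/
noncomputable def Phi (z : ℝ) : ℝ :=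
  ∫ u in Set.Iic z, (Real.sqrt (2 * Real.pi))⁻¹ * Real.exp (-u ^ 2 / 2)

open Set Filter Topology MeasureTheory Real

/-- The standard normal density. -/
noncomputable def gaussDensity (u : ℝ) : ℝ := (√(2 * π))⁻¹ * exp (-u ^ 2 / 2)

/-- The standard normal mass of the interval `[0, s]`. -/
noncomputable def gaussMass (s : ℝ) : ℝ := ∫ u in (0 : ℝ)..s, gaussDensity u

/-- The sign of the derivative of the efficiency at `s > 0` is that of this function. -/
noncomputable def slopeSign (s : ℝ) : ℝ :=
  2 * gaussMass s - 4 * gaussMass s ^ 2 - s * gaussDensity s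

/-- The derivative of `slopeSign` is the normal density times this function. -/
noncomputable def slopeFactor (s : ℝ) : ℝ := 1 + s ^ 2 - 8 * gaussMass s

lemma continuous_gaussDensity : Continuous gaussDensity := by
  unfold gaussDensity; fun_prop

lemma gaussDensity_pos (u : ℝ) : 0 < gaussDensity u := by
  unfold gaussDensity; positivity

lemma gaussDensity_neg (u : ℝ) : gaussDensity (-u) = gaussDensity u := by
  simp [gaussDensity]

lemma integrable_gaussDensity : Integrable gaussDensity := by
  have h := (integrable_exp_neg_mul_sq (b := 1 / 2) (by norm_num)).const_mul (√(2 * π))⁻¹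
  refine h.congr (Eventually.of_forall fun x => ?_)
  simp only [gaussDensity]
  ring_nf

lemma integral_Ioi_gaussDensity : ∫ u in Ioi (0 : ℝ), gaussDensity u = 1 / 2 := by
  have h := integral_gaussian_Ioi (1 / 2)
  have h2 : (fun u => gaussDensity u) =
      fun u : ℝ => (√(2 * π))⁻¹ * exp (-(1 / 2) * u ^ 2) := by
    ext u
    simp only [gaussDensity]
    ring_nf
  have h3 : √(2 * π) ≠ 0 := by positivity
  rw [h2, integral_const_mul, h, show π / (1 / 2) = 2 * π by ring]
  field_simp

lemma Phi_neg (s : ℝ) : Phi (-s) = 1 / 2 - gaussMass s := by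
  have h1 : Phi (-s) = ∫ u in Iic (-s), gaussDensity (-u) := by
    simp only [gaussDensity_neg]; rfl
  have h2 := intervalIntegral.integral_interval_add_Ioi (a := 0) (b := s)
    integrable_gaussDensity.integrableOn integrable_gaussDensity.integrableOn
  rw [integral_Ioi_gaussDensity] at h2
  rw [h1, integral_comp_neg_Iic, neg_neg, gaussMass]
  linarith

lemma hasDerivAt_gaussMass (s : ℝ) : HasDerivAt gaussMass (gaussDensity s) s :=
  intervalIntegral.integral_hasDerivAt_right
    (continuous_gaussDensity.intervalIntegrable _ _)
    (continuous_gaussDensity.stronglyMeasurableAtFilter _ _) continuous_gaussDensity.continuousAt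

lemma strictMono_gaussMass : StrictMono gaussMass :=
  strictMono_of_hasDerivAt_pos hasDerivAt_gaussMass gaussDensity_pos

lemma gaussMass_zero : gaussMass 0 = 0 := by simp [gaussMass]

lemma gaussMass_pos {s : ℝ} (hs : 0 < s) : 0 < gaussMass s := by
  simpa [gaussMass_zero] using strictMono_gaussMass hs

lemma tendsto_gaussMass : Tendsto gaussMass atTop (𝓝 (1 / 2)) := by
  rw [← integral_Ioi_gaussDensity]
  exact intervalIntegral_tendsto_integral_Ioi 0 integrable_gaussDensity.integrableOn tendsto_id

lemma hasDerivAt_gaussDensity (s : ℝ) :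
    HasDerivAt gaussDensity (-s * gaussDensity s) s := by
  have h : HasDerivAt (fun u : ℝ => -u ^ 2 / 2) (-s) s := by
    have := ((hasDerivAt_pow 2 s).neg).div_const 2
    exact this.congr_deriv (by push_cast; ring)
  have := (h.exp).const_mul (√(2 * π))⁻¹
  refine this.congr_deriv ?_
  simp only [gaussDensity]
  ring

lemma hasDerivAt_slopeSign (s : ℝ) :
    HasDerivAt slopeSign (gaussDensity s * slopeFactor s) s := by
  have h := (((hasDerivAt_gaussMass s).const_mul 2).sub
    (((hasDerivAt_gaussMass s).pow 2).const_mul 4)).sub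
    ((hasDerivAt_id s).mul (hasDerivAt_gaussDensity s))
  refine h.congr_deriv ?_
  simp only [slopeFactor, id]
  push_cast
  ring

lemma hasDerivAt_slopeFactor (s : ℝ) :
    HasDerivAt slopeFactor (2 * s - 8 * gaussDensity s) s := by
  have h := ((hasDerivAt_pow 2 s).const_add 1).sub ((hasDerivAt_gaussMass s).const_mul 8)
  exact h.congr_deriv (by simp)

lemma continuous_slopeSign : Continuous slopeSign :=
  continuous_iff_continuousAt.2 fun s => (hasDerivAt_slopeSign s).continuousAt

lemma continuous_slopeFactor : Continuous slopeFactor :=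
  continuous_iff_continuousAt.2 fun s => (hasDerivAt_slopeFactor s).continuousAt

lemma slopeSign_zero : slopeSign 0 = 0 := by simp [slopeSign, gaussMass_zero]

lemma strictConvexOn_slopeFactor : StrictConvexOn ℝ (Ici 0) slopeFactor := by
  refine StrictMonoOn.strictConvexOn_of_deriv (convex_Ici 0) continuous_slopeFactor.continuousOn ?_
  intro x hx y hy hxy
  rw [interior_Ici, mem_Ioi] at hx hy
  rw [(hasDerivAt_slopeFactor x).deriv, (hasDerivAt_slopeFactor y).deriv]
  have : gaussDensity y ≤ gaussDensity x := by
    unfold gaussDensity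
    gcongr
  linarith

lemma slopeFactor_lt_max {x y z : ℝ} (hx : 0 ≤ x) (hxz : x < z) (hzy : z < y) :
    slopeFactor z < max (slopeFactor x) (slopeFactor y) := by
  refine strictConvexOn_slopeFactor.lt_on_openSegment hx
    (hx.trans (hxz.trans hzy).le) (hxz.trans hzy).ne ?_
  rw [openSegment_eq_Ioo (hxz.trans hzy)]
  exact ⟨hxz, hzy⟩

lemma strictMonoOn_slopeSign {D : Set ℝ} (hD : Convex ℝ D)
    (h : ∀ x ∈ interior D, 0 < slopeFactor x) : StrictMonoOn slopeSign D := by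
  refine strictMonoOn_of_deriv_pos hD continuous_slopeSign.continuousOn fun x hx => ?_
  rw [(hasDerivAt_slopeSign x).deriv]
  exact mul_pos (gaussDensity_pos x) (h x hx)

lemma strictAntiOn_slopeSign {D : Set ℝ} (hD : Convex ℝ D)
    (h : ∀ x ∈ interior D, slopeFactor x < 0) : StrictAntiOn slopeSign D := by
  refine strictAntiOn_of_deriv_neg hD continuous_slopeSign.continuousOn fun x hx => ?_
  rw [(hasDerivAt_slopeSign x).deriv]
  exact mul_neg_of_pos_of_neg (gaussDensity_pos x) (h x hx)

lemma tendsto_slopeSign : Tendsto slopeSign atTop (𝓝 0) := by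
  have h0 : Tendsto (fun s : ℝ => s * gaussDensity s) atTop (𝓝 0) := by
    have h := (tendsto_pow_mul_exp_neg_atTop_nhds_zero 1).const_mul (√(2 * π))⁻¹
    rw [mul_zero] at h
    refine squeeze_zero' ?_ ?_ h
    · filter_upwards [eventually_ge_atTop 0] with s hs
      exact mul_nonneg hs (gaussDensity_pos s).le
    · filter_upwards [eventually_ge_atTop 2] with s hs
      rw [gaussDensity, pow_one, mul_left_comm]
      gcongr
      nlinarith
  have h := ((tendsto_gaussMass.const_mul 2).sub ((tendsto_gaussMass.pow 2).const_mul 4)).sub h0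
  norm_num at h
  exact h

lemma slopeSign_pos_of_lt {s t : ℝ} (hs : 0 ≤ slopeSign s) (hk : slopeFactor s < 0)
    (ht : 0 < t) (hts : t < s) : 0 < slopeSign t := by
  rcases lt_or_ge (slopeFactor t) 0 with h | h
  · have hanti : StrictAntiOn slopeSign (Icc t s) := by
      refine strictAntiOn_slopeSign (convex_Icc t s) fun x hx => ?_
      rw [interior_Icc] at hx
      exact (slopeFactor_lt_max ht.le hx.1 hx.2).trans (max_lt h hk)
    exact hs.trans_lt (hanti (left_mem_Icc.2 hts.le) (right_mem_Icc.2 hts.le) hts)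
  · have hmono : StrictMonoOn slopeSign (Icc 0 t) := by
      refine strictMonoOn_slopeSign (convex_Icc 0 t) fun x hx => ?_
      rw [interior_Icc] at hx
      by_contra! hx0
      have := slopeFactor_lt_max hx.1.le hx.2 hts
      exact absurd (this.trans_le (max_le hx0 hk.le)) h.not_gt
    simpa [slopeSign_zero] using hmono (left_mem_Icc.2 ht.le) (right_mem_Icc.2 ht.le) ht

lemma slopeSign_neg_of_gt {s t : ℝ} (hs0 : 0 ≤ s) (hs : slopeSign s ≤ 0)
    (hk : slopeFactor s < 0) (hst : s < t) : slopeSign t < 0 := by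
  rcases lt_or_ge (slopeFactor t) 0 with h | h
  · have hanti : StrictAntiOn slopeSign (Icc s t) := by
      refine strictAntiOn_slopeSign (convex_Icc s t) fun x hx => ?_
      rw [interior_Icc] at hx
      exact (slopeFactor_lt_max hs0 hx.1 hx.2).trans (max_lt hk h)
    exact (hanti (left_mem_Icc.2 hst.le) (right_mem_Icc.2 hst.le) hst).trans_le hs
  · have hmono : StrictMonoOn slopeSign (Ici t) := by
      refine strictMonoOn_slopeSign (convex_Ici t) fun x hx => ?_
      rw [interior_Ici] at hx
      by_contra! hx0
      have := slopeFactor_lt_max hs0 hst hx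
      exact absurd (this.trans_le (max_le hk.le hx0)) h.not_gt
    have h1 : slopeSign t < slopeSign (t + 1) :=
      hmono self_mem_Ici (mem_Ici.2 (by linarith)) (by linarith)
    refine h1.trans_le (ge_of_tendsto tendsto_slopeSign ?_)
    filter_upwards [eventually_ge_atTop (t + 1)] with x hx
    exact hmono.monotoneOn (mem_Ici.2 (by linarith)) (mem_Ici.2 (by linarith)) hx

/-- The Taylor polynomial of degree `12` approximates `exp (-u ^ 2 / 2)` on `[0, 1]`. -/
lemma abs_exp_neg_half_sq_sub_le {u : ℝ} (h0 : 0 ≤ u) (h1 : u ≤ 1) :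
    |exp (-u ^ 2 / 2) - (1 - u ^ 2 / 2 + u ^ 4 / 8 - u ^ 6 / 48 + u ^ 8 / 384 - u ^ 10 / 3840
      + u ^ 12 / 46080)| ≤ u ^ 14 / 500000 := by
  have hu : u ^ 2 ≤ 1 := pow_le_one₀ h0 h1
  have hx : |-u ^ 2 / 2| = u ^ 2 / 2 := by
    rw [abs_of_nonpos (by nlinarith [sq_nonneg u])]; ring
  have h := Real.exp_bound (x := -u ^ 2 / 2) (by rw [hx]; linarith) (n := 7) (by norm_num)
  rw [hx] at h
  have e : ∑ m ∈ Finset.range 7, (-u ^ 2 / 2) ^ m / (m.factorial : ℝ) =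
      1 - u ^ 2 / 2 + u ^ 4 / 8 - u ^ 6 / 48 + u ^ 8 / 384 - u ^ 10 / 3840 + u ^ 12 / 46080 := by
    simp only [Finset.sum_range_succ, Finset.sum_range_zero, Nat.factorial]
    push_cast
    ring
  rw [e] at h
  refine h.trans ?_
  norm_num [Nat.factorial]
  nlinarith [pow_nonneg h0 14]

lemma abs_integral_exp_neg_half_sq_sub_le {s : ℝ} (h0 : 0 ≤ s) (h1 : s ≤ 1) :
    |(∫ u in (0 : ℝ)..s, exp (-u ^ 2 / 2)) - (s - s ^ 3 / 6 + s ^ 5 / 40 - s ^ 7 / 336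
      + s ^ 9 / 3456 - s ^ 11 / 42240 + s ^ 13 / 599040)| ≤ s ^ 15 / 7500000 := by
  have key : ∀ x ∈ Icc (0 : ℝ) s, HasDerivAt (fun s : ℝ => s - s ^ 3 / 6 + s ^ 5 / 40
      - s ^ 7 / 336 + s ^ 9 / 3456 - s ^ 11 / 42240 + s ^ 13 / 599040)
      (1 - x ^ 2 / 2 + x ^ 4 / 8 - x ^ 6 / 48 + x ^ 8 / 384 - x ^ 10 / 3840
      + x ^ 12 / 46080) x := by
    intro x _
    have h := ((((((hasDerivAt_id x).sub ((hasDerivAt_pow 3 x).div_const 6)).add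
      ((hasDerivAt_pow 5 x).div_const 40)).sub ((hasDerivAt_pow 7 x).div_const 336)).add
      ((hasDerivAt_pow 9 x).div_const 3456)).sub ((hasDerivAt_pow 11 x).div_const 42240)).add
      ((hasDerivAt_pow 13 x).div_const 599040)
    refine h.congr_deriv ?_
    push_cast
    ring
  have hP : ∫ u in (0 : ℝ)..s, (1 - u ^ 2 / 2 + u ^ 4 / 8 - u ^ 6 / 48 + u ^ 8 / 384
      - u ^ 10 / 3840 + u ^ 12 / 46080) = s - s ^ 3 / 6 + s ^ 5 / 40 - s ^ 7 / 336
      + s ^ 9 / 3456 - s ^ 11 / 42240 + s ^ 13 / 599040 := by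
    rw [intervalIntegral.integral_eq_sub_of_hasDerivAt (by rwa [uIcc_of_le h0])
      (Continuous.intervalIntegrable (by fun_prop) _ _)]
    norm_num
  have hR : ∫ u in (0 : ℝ)..s, u ^ 14 / 500000 = s ^ 15 / 7500000 := by
    rw [intervalIntegral.integral_div, integral_pow]
    norm_num
    ring
  rw [← hP, ← hR, ← intervalIntegral.integral_sub
    (Continuous.intervalIntegrable (by fun_prop) _ _)
    (Continuous.intervalIntegrable (by fun_prop) _ _)]
  refine (intervalIntegral.abs_integral_le_integral_abs h0).trans ?_
  refine intervalIntegral.integral_mono_on h0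
    (Continuous.intervalIntegrable (by fun_prop) _ _)
    (Continuous.intervalIntegrable (by fun_prop) _ _) fun u hu => ?_
  exact abs_exp_neg_half_sq_sub_le hu.1 (hu.2.trans h1)

lemma inv_sqrt_two_pi_bounds :
    0.3989422 < (√(2 * π))⁻¹ ∧ (√(2 * π))⁻¹ < 0.3989424 := by
  have hp : 0 < √(2 * π) := by positivity
  have h1 := pi_gt_d6
  have h2 := pi_lt_d6
  constructor
  · rw [lt_inv_comm₀ (by norm_num) hp, Real.sqrt_lt' (by norm_num)]
    norm_num
    linarith
  · rw [inv_lt_comm₀ hp (by norm_num), Real.lt_sqrt (by norm_num)]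
    norm_num
    linarith

lemma gaussMass_eq (s : ℝ) :
    gaussMass s = (√(2 * π))⁻¹ * ∫ u in (0 : ℝ)..s, exp (-u ^ 2 / 2) := by
  simp only [gaussMass, gaussDensity, intervalIntegral.integral_const_mul]

lemma gaussMass_left_bounds : 0.306205 < gaussMass 0.864 ∧ gaussMass 0.864 < 0.306207 := by
  have h := abs_le.1 (abs_integral_exp_neg_half_sq_sub_le (s := 0.864) (by norm_num) (by norm_num))
  have hc := inv_sqrt_two_pi_bounds
  rw [gaussMass_eq]
  norm_num at h hc ⊢
  constructor <;> nlinarith [h.1, h.2, hc.1, hc.2]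

lemma gaussMass_right_bounds : 0.306480 < gaussMass 0.865 ∧ gaussMass 0.865 < 0.306482 := by
  have h := abs_le.1 (abs_integral_exp_neg_half_sq_sub_le (s := 0.865) (by norm_num) (by norm_num))
  have hc := inv_sqrt_two_pi_bounds
  rw [gaussMass_eq]
  norm_num at h hc ⊢
  constructor <;> nlinarith [h.1, h.2, hc.1, hc.2]

lemma gaussDensity_left_lt : gaussDensity 0.864 < 0.274671 := by
  have h := abs_le.1 (abs_exp_neg_half_sq_sub_le (u := 0.864) (by norm_num) (by norm_num))
  have hc := inv_sqrt_two_pi_bounds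
  rw [gaussDensity]
  norm_num at h hc ⊢
  nlinarith [h.1, h.2, hc.1, hc.2]

lemma lt_gaussDensity_right : 0.274430 < gaussDensity 0.865 := by
  have h := abs_le.1 (abs_exp_neg_half_sq_sub_le (u := 0.865) (by norm_num) (by norm_num))
  have hc := inv_sqrt_two_pi_bounds
  rw [gaussDensity]
  norm_num at h hc ⊢
  nlinarith [h.1, h.2, hc.1, hc.2]

lemma slopeSign_left_pos : 0 < slopeSign 0.864 := by
  have h := gaussMass_left_bounds
  have h' := gaussDensity_left_lt
  rw [slopeSign]
  nlinarith [h.1, h.2]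

lemma slopeSign_right_neg : slopeSign 0.865 < 0 := by
  have h := gaussMass_right_bounds
  have h' := lt_gaussDensity_right
  rw [slopeSign]
  nlinarith [h.1, h.2]

lemma slopeFactor_neg {s : ℝ} (h1 : 0.864 < s) (h2 : s < 0.865) : slopeFactor s < 0 := by
  refine (slopeFactor_lt_max (by norm_num) h1 h2).trans (max_lt ?_ ?_)
  · have := gaussMass_left_bounds.1
    rw [slopeFactor]
    norm_num at this ⊢
    linarith
  · have := gaussMass_right_bounds.1
    rw [slopeFactor]
    norm_num at this ⊢
    linarith

lemma exists_slopeSign_eq_zero : ∃ s, (0.864 < s ∧ s < 0.865) ∧ slopeSign s = 0 := by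
  obtain ⟨s, hs, h⟩ := intermediate_value_Ioo' (show (0.864 : ℝ) ≤ 0.865 by norm_num)
    continuous_slopeSign.continuousOn ⟨slopeSign_right_neg, slopeSign_left_pos⟩
  exact ⟨s, hs, h⟩

/-- The efficiency as a function of `s`. -/
noncomputable def efficiency (s : ℝ) : ℝ := s ^ 2 * Phi (-s) / (1 - 2 * Phi (-s))

lemma hasDerivAt_efficiency {s : ℝ} (hs : 0 < s) :
    HasDerivAt efficiency (s * slopeSign s / (4 * gaussMass s ^ 2)) s := by
  have hG := gaussMass_pos hs
  have e : efficiency = fun s => s ^ 2 * (1 / 2 - gaussMass s) / (2 * gaussMass s) := by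
    ext s
    rw [efficiency, Phi_neg]
    congr 1
    ring
  have h := (((hasDerivAt_pow 2 s).mul ((hasDerivAt_gaussMass s).const_sub (1 / 2))).div
    ((hasDerivAt_gaussMass s).const_mul 2) (by positivity))
  rw [e]
  refine h.congr_deriv ?_
  simp only [slopeSign, Pi.mul_apply]
  field_simp
  ring

lemma efficiency_lt {s t : ℝ} (hs : 0 < s) (h0 : slopeSign s = 0) (hk : slopeFactor s < 0)
    (ht : 0 < t) (hne : t ≠ s) : efficiency t < efficiency s := by
  rcases hne.lt_or_gt with h | h
  · have hmono : StrictMonoOn efficiency (Icc t s) := by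
      refine strictMonoOn_of_deriv_pos (convex_Icc t s) (fun x hx =>
        (hasDerivAt_efficiency (ht.trans_le hx.1)).continuousAt.continuousWithinAt) fun x hx => ?_
      rw [interior_Icc] at hx
      have hx0 := ht.trans hx.1
      rw [(hasDerivAt_efficiency hx0).deriv]
      have := slopeSign_pos_of_lt h0.ge hk hx0 hx.2
      have := gaussMass_pos hx0
      positivity
    exact hmono (left_mem_Icc.2 h.le) (right_mem_Icc.2 h.le) h
  · have hanti : StrictAntiOn efficiency (Icc s t) := by
      refine strictAntiOn_of_deriv_neg (convex_Icc s t) (fun x hx =>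
        (hasDerivAt_efficiency (hs.trans_le hx.1)).continuousAt.continuousWithinAt) fun x hx => ?_
      rw [interior_Icc] at hx
      have hx0 := hs.trans hx.1
      rw [(hasDerivAt_efficiency hx0).deriv]
      have := slopeSign_neg_of_gt hs.le h0.le hk hx.1
      have := gaussMass_pos hx0
      exact div_neg_of_neg_of_pos (mul_neg_of_pos_of_neg hx0 ‹_›) (by positivity)
    exact hanti (left_mem_Icc.2 h.le) (right_mem_Icc.2 h.le) h

/-- the function h(s) = s^2 * Phi(-s) / (1 - 2 Phi(-s)) attains
its maximum over (0,∞) at a unique point s**, with 0.864 < s** < 0.865,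
0.386 < 2 Phi(-s**) < 0.388, and
1.88 < 8 (s**)^2 Phi(-s**)/(1 - 2 Phi(-s**)) < 1.90. -/
theorem nonreversible_optimal_scaling :
    ∃ s : ℝ, (s ∈ Set.Ioi (0:ℝ) ∧
        IsMaxOn (fun s : ℝ => s ^ 2 * Phi (-s) / (1 - 2 * Phi (-s))) (Set.Ioi 0) s) ∧
      (∀ s' : ℝ, s' ∈ Set.Ioi (0:ℝ) ∧
        IsMaxOn (fun s : ℝ => s ^ 2 * Phi (-s) / (1 - 2 * Phi (-s))) (Set.Ioi 0) s' → s' = s) ∧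
      (0.864 < s ∧ s < 0.865) ∧
      (0.386 < 2 * Phi (-s) ∧ 2 * Phi (-s) < 0.388) ∧
      (1.88 < 8 * s ^ 2 * Phi (-s) / (1 - 2 * Phi (-s)) ∧
        8 * s ^ 2 * Phi (-s) / (1 - 2 * Phi (-s)) < 1.90) := by
  obtain ⟨s, ⟨h1, h2⟩, h0⟩ := exists_slopeSign_eq_zero
  have hk := slopeFactor_neg h1 h2
  have hs : 0 < s := lt_trans (by norm_num) h1
  have hlt : ∀ t, 0 < t → t ≠ s → efficiency t < efficiency s :=
    fun t ht hne => efficiency_lt hs h0 hk ht hne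
  have hG1 : 0.306205 < gaussMass s := gaussMass_left_bounds.1.trans (strictMono_gaussMass h1)
  have hG2 : gaussMass s < 0.306482 := (strictMono_gaussMass h2).trans gaussMass_right_bounds.2
  have hq1 : 0.746496 < s ^ 2 := by nlinarith
  have hq2 : s ^ 2 < 0.748225 := by nlinarith
  refine ⟨s, ⟨hs, ?_⟩, ?_, ⟨h1, h2⟩, ?_, ?_⟩
  · intro t ht
    rcases eq_or_ne t s with rfl | hne
    · exact le_refl (efficiency t)
    · exact (hlt t ht hne).le
  · rintro t ⟨ht, hmax⟩
    by_contra hne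
    exact absurd (hmax (mem_Ioi.2 hs)) (hlt t ht hne).not_ge
  · rw [Phi_neg]
    constructor <;> norm_num at hG1 hG2 ⊢ <;> linarith
  · have hd : 0 < 1 - 2 * (1 / 2 - gaussMass s) := by norm_num at hG1; linarith
    rw [Phi_neg, lt_div_iff₀ hd, div_lt_iff₀ hd]
    norm_num at hG1 hG2 hq1 hq2 ⊢
    constructor <;> nlinarith
end

section
/- Let A, B, C be nonnegative reals with A+B+C=1 and C>0, and let (X_n, Y_n) be the double-birth-death Markov chain started at (0,+). Let T₁ be the first time n ≥ 1 at which Y_n = + and the chain has previously visited the row {−}. Then Var(X_{T₁}) = 2·[(A−B)²/C²] + 2·[(1−C)/C]. -/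
open MeasureTheory ProbabilityTheory

/-- One-step transition probabilities of the double-birth-death Markov chain on
ℤ × Bool (`true` is the "+" row, `false` is the "−" row): from (i,+) it moves to
(i+1,+) w.p. A, to (i-1,+) w.p. B, to (i,−) w.p. C; from (i,−) it moves to
(i-1,−) w.p. A, to (i+1,−) w.p. B, to (i,+) w.p. C. -/
def dbdStep (A B C : ℝ) : ℤ × Bool → ℤ × Bool → ℝ
  | (i, true), (j, true) => if j = i + 1 then A else if j = i - 1 then B else 0
  | (i, true), (j, false) => if j = i then C else 0
  | (i, false), (j, false) => if j = i - 1 then A else if j = i + 1 then B else 0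
  | (i, false), (j, true) => if j = i then C else 0

/-- `(X, Y)` is (a realisation of) the double-birth-death Markov chain with
parameters A, B, C started at (0,+): the probability of any finite path equals
the indicator of starting at (0, +) times the product of the one-step
transition probabilities along the path. -/
def IsDBDChain {Ω : Type*} [MeasurableSpace Ω] (μ : Measure Ω) (A B C : ℝ)
    (X : ℕ → Ω → ℤ) (Y : ℕ → Ω → Bool) : Prop :=
  (∀ n, Measurable (X n)) ∧ (∀ n, Measurable (Y n)) ∧
    ∀ (n : ℕ) (s : ℕ → ℤ × Bool),
      (μ {ω | ∀ k ≤ n, (X k ω, Y k ω) = s k}).toReal =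
        (if s 0 = ((0 : ℤ), true) then (1 : ℝ) else 0) *
          ∏ k ∈ Finset.range n, dbdStep A B C (s k) (s (k + 1))

/-- The first time n ≥ 1 at which the chain is in the "+" row having previously
visited the "−" row. -/
noncomputable def T1 {Ω : Type*} (Y : ℕ → Ω → Bool) (ω : Ω) : ℕ :=
  sInf {n | 1 ≤ n ∧ Y n ω = true ∧ ∃ m < n, Y m ω = false}

/-- A linear recursion `x (n + 1) = (1 - c) * x n + y n` with summable forcing is summable. -/
theorem hasSum_of_linear_recursion {c s : ℝ} (hc : 0 < c) (hc1 : c ≤ 1) {x y : ℕ → ℝ}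
    (hrec : ∀ n, x (n + 1) = (1 - c) * x n + y n) (hy : HasSum y s) :
    HasSum x ((x 0 + s) / c) := by
  have hyn : Summable fun n => ‖y n‖ := hy.summable.norm
  have hbound : ∀ N, c * ∑ n ∈ Finset.range N, ‖x n‖ + ‖x N‖ ≤
      ‖x 0‖ + ∑ n ∈ Finset.range N, ‖y n‖ := by
    intro N
    induction N with
    | zero => simp
    | succ N ih =>
      have h1 : ‖x (N + 1)‖ ≤ (1 - c) * ‖x N‖ + ‖y N‖ := by
        rw [hrec]
        refine (norm_add_le _ _).trans ?_
        rw [norm_mul, Real.norm_of_nonneg (sub_nonneg.2 hc1)]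
      rw [Finset.sum_range_succ, Finset.sum_range_succ]
      linarith
  have hx : Summable x := by
    refine Summable.of_norm (summable_of_sum_range_le (c := (‖x 0‖ + ∑' n, ‖y n‖) / c)
      (fun n => norm_nonneg _) fun N => ?_)
    rw [le_div_iff₀ hc]
    have := hyn.sum_le_tsum (Finset.range N) fun n _ => norm_nonneg _
    linarith [hbound N, norm_nonneg (x N)]
  have h1 : HasSum (fun n => x (n + 1)) ((1 - c) * ∑' n, x n + s) := by
    simpa only [hrec] using (hx.hasSum.mul_left (1 - c)).add hy
  have h2 := hx.tsum_eq_zero_add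
  rw [h1.tsum_eq] at h2
  convert hx.hasSum using 1
  rw [div_eq_iff hc.ne']
  linarith

/-- The measure `ρ` on `ℤ` has finite moments of order `0`, `1`, `2`, listed by `m`. -/
structure HasMoments (ρ : Measure ℤ) (m : ℝ × ℝ × ℝ) : Prop where
  integrable_one : Integrable (fun _ : ℤ => (1 : ℝ)) ρ
  integrable_id : Integrable (fun x : ℤ => (x : ℝ)) ρ
  integrable_sq : Integrable (fun x : ℤ => (x : ℝ) ^ 2) ρ
  integral_one : ∫ _x : ℤ, (1 : ℝ) ∂ρ = m.1
  integral_id : ∫ x : ℤ, (x : ℝ) ∂ρ = m.2.1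
  integral_sq : ∫ x : ℤ, (x : ℝ) ^ 2 ∂ρ = m.2.2

namespace HasMoments

theorem zero : HasMoments 0 (0, 0, 0) := by
  constructor <;> simp

theorem dirac_zero : HasMoments (Measure.dirac 0) (1, 0, 0) := by
  constructor <;> first | exact integrable_dirac (by simp) | simp

theorem add {ρ σ : Measure ℤ} {m m' : ℝ × ℝ × ℝ} (h : HasMoments ρ m) (h' : HasMoments σ m') :
    HasMoments (ρ + σ) (m + m') where
  integrable_one := h.integrable_one.add_measure h'.integrable_one
  integrable_id := h.integrable_id.add_measure h'.integrable_id
  integrable_sq := h.integrable_sq.add_measure h'.integrable_sq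
  integral_one := by
    rw [integral_add_measure h.integrable_one h'.integrable_one, h.integral_one, h'.integral_one]
    rfl
  integral_id := by
    rw [integral_add_measure h.integrable_id h'.integrable_id, h.integral_id, h'.integral_id]
    rfl
  integral_sq := by
    rw [integral_add_measure h.integrable_sq h'.integrable_sq, h.integral_sq, h'.integral_sq]
    rfl

theorem smul {ρ : Measure ℤ} {m : ℝ × ℝ × ℝ} (h : HasMoments ρ m) {c : ℝ} (hc : 0 ≤ c) :
    HasMoments (ENNReal.ofReal c • ρ) (c • m) where
  integrable_one := h.integrable_one.smul_measure ENNReal.ofReal_ne_top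
  integrable_id := h.integrable_id.smul_measure ENNReal.ofReal_ne_top
  integrable_sq := h.integrable_sq.smul_measure ENNReal.ofReal_ne_top
  integral_one := by
    rw [integral_smul_measure, h.integral_one, ENNReal.toReal_ofReal hc]
    rfl
  integral_id := by
    rw [integral_smul_measure, h.integral_id, ENNReal.toReal_ofReal hc]
    rfl
  integral_sq := by
    rw [integral_smul_measure, h.integral_sq, ENNReal.toReal_ofReal hc]
    rfl

theorem map_add {ρ : Measure ℤ} {m : ℝ × ℝ × ℝ} (h : HasMoments ρ m) (d : ℤ) :
    HasMoments (ρ.map (· + d)) (m.1, m.2.1 + d * m.1, m.2.2 + (2 * d * m.2.1 + d ^ 2 * m.1)) := by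
  have hd : AEMeasurable (· + d) ρ := Measurable.of_discrete.aemeasurable
  have hs : ∀ f : ℤ → ℝ, AEStronglyMeasurable f (ρ.map (· + d)) := fun f =>
    (Measurable.of_discrete (f := f)).aestronglyMeasurable
  have hint : Integrable (fun x : ℤ => d * (1 : ℝ)) ρ := h.integrable_one.const_mul _
  have h2 : Integrable (fun x : ℤ => 2 * d * (x : ℝ)) ρ := h.integrable_id.const_mul _
  have h1 : Integrable (fun x : ℤ => (d : ℝ) ^ 2 * 1) ρ := h.integrable_one.const_mul _
  have h21 : Integrable (fun x : ℤ => 2 * d * (x : ℝ) + (d : ℝ) ^ 2 * 1) ρ := h2.add h1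
  have e1 : (fun x : ℤ => ((x + d : ℤ) : ℝ)) = fun x : ℤ => (x : ℝ) + d * 1 := by
    ext x; push_cast; ring
  have e2 : (fun x : ℤ => ((x + d : ℤ) : ℝ) ^ 2) =
      fun x : ℤ => (x : ℝ) ^ 2 + (2 * d * (x : ℝ) + (d : ℝ) ^ 2 * 1) := by
    ext x; push_cast; ring
  constructor
  · exact (integrable_map_measure (hs _) hd).2 h.integrable_one
  · refine (integrable_map_measure (hs _) hd).2 ?_
    simp only [Function.comp_def]
    rw [e1]
    exact h.integrable_id.add hint
  · refine (integrable_map_measure (hs _) hd).2 ?_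
    simp only [Function.comp_def]
    rw [e2]
    exact h.integrable_sq.add h21
  · rw [integral_map hd (hs _)]
    exact h.integral_one
  · rw [integral_map hd (hs _), e1, integral_add h.integrable_id hint, integral_const_mul,
      h.integral_id, h.integral_one]
  · rw [integral_map hd (hs _), e2, integral_add h.integrable_sq h21,
      integral_add h2 h1, integral_const_mul, integral_const_mul, h.integral_id, h.integral_one,
      h.integral_sq]

end HasMoments

/-- One step of a killed nearest-neighbour walk on `ℤ`, acting on measures. -/
noncomputable def walkStep (p q : ℝ) (ρ : Measure ℤ) : Measure ℤ :=
  ENNReal.ofReal p • ρ.map (· + 1) + ENNReal.ofReal q • ρ.map (· + (-1))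

theorem walkStep_singleton (p q : ℝ) (ρ : Measure ℤ) (i : ℤ) :
    walkStep p q ρ {i} =
      ENNReal.ofReal p * ρ {i - 1} + ENNReal.ofReal q * ρ {i + 1} := by
  have h : ∀ d : ℤ, ρ.map (· + d) {i} = ρ {i - d} := fun d => by
    rw [Measure.map_apply Measurable.of_discrete (measurableSet_singleton i)]
    congr 1
    ext x
    simp only [Set.mem_preimage, Set.mem_singleton_iff, eq_sub_iff_add_eq]
  simp [walkStep, h]

/-- The effect of `walkStep` on the moments of order `0`, `1`, `2`. -/
def momentStep (p q : ℝ) (m : ℝ × ℝ × ℝ) : ℝ × ℝ × ℝ :=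
  ((p + q) * m.1, (p + q) * m.2.1 + (p - q) * m.1,
    (p + q) * m.2.2 + (2 * (p - q) * m.2.1 + (p + q) * m.1))

theorem HasMoments.walkStep {p q : ℝ} (hp : 0 ≤ p) (hq : 0 ≤ q) {ρ : Measure ℤ}
    {m : ℝ × ℝ × ℝ} (h : HasMoments ρ m) :
    HasMoments (walkStep p q ρ) (momentStep p q m) := by
  have key := ((h.map_add 1).smul hp).add ((h.map_add (-1)).smul hq)
  have hm : momentStep p q m = p • (m.1, m.2.1 + ((1 : ℤ) : ℝ) * m.1,
        m.2.2 + (2 * ((1 : ℤ) : ℝ) * m.2.1 + ((1 : ℤ) : ℝ) ^ 2 * m.1)) +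
      q • (m.1, m.2.1 + ((-1 : ℤ) : ℝ) * m.1,
        m.2.2 + (2 * ((-1 : ℤ) : ℝ) * m.2.1 + ((-1 : ℤ) : ℝ) ^ 2 * m.1)) := by
    simp only [momentStep, Prod.smul_mk, Prod.mk_add_mk, smul_eq_mul, Prod.mk.injEq]
    push_cast
    refine ⟨?_, ?_, ?_⟩ <;> ring
  rw [hm]
  exact key

section Paths

variable {Ω : Type*} {X : ℕ → Ω → ℤ} {Y : ℕ → Ω → Bool}

/-- The path of the chain up to time `n`. -/
def history (X : ℕ → Ω → ℤ) (Y : ℕ → Ω → Bool) (n : ℕ) (ω : Ω) : Fin (n + 1) → ℤ × Bool :=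
  fun k => (X k ω, Y k ω)

/-- Paths that stay in the `+` row. -/
def plusPhase (n : ℕ) : Set (Fin (n + 1) → ℤ × Bool) :=
  {p | ∀ k, (p k).2 = true}

/-- Paths that end in the `-` row and have not returned from it. -/
def minusPhase (n : ℕ) : Set (Fin (n + 1) → ℤ × Bool) :=
  {p | (p (Fin.last n)).2 = false ∧ ∀ j k, j < k → (p j).2 = false → (p k).2 = false}

theorem mem_plusPhase {n : ℕ} {ω : Ω} :
    ω ∈ history X Y n ⁻¹' plusPhase n ↔ ∀ k ≤ n, Y k ω = true :=
  ⟨fun h k hk => h ⟨k, Nat.lt_succ_iff.2 hk⟩, fun h k => h k (Nat.lt_succ_iff.1 k.2)⟩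

theorem mem_minusPhase {n : ℕ} {ω : Ω} :
    ω ∈ history X Y n ⁻¹' minusPhase n ↔
      Y n ω = false ∧ ∀ j k, j < k → k ≤ n → Y j ω = false → Y k ω = false :=
  ⟨fun h => ⟨h.1, fun j k hjk hk => h.2 ⟨j, by lia⟩ ⟨k, by lia⟩ hjk⟩,
    fun h => ⟨h.1, fun j k hjk => h.2 j k hjk (Nat.lt_succ_iff.1 k.2)⟩⟩

theorem plusPhase_succ (n : ℕ) :
    history X Y (n + 1) ⁻¹' plusPhase (n + 1) =
      history X Y n ⁻¹' plusPhase n ∩ {ω | Y (n + 1) ω = true} := by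
  ext ω
  rw [mem_plusPhase, Set.mem_inter_iff, mem_plusPhase]
  simp only [Nat.le_add_one_iff, or_imp, forall_and, forall_eq, Set.mem_ofPred_eq]

theorem minusPhase_succ (n : ℕ) :
    history X Y (n + 1) ⁻¹' minusPhase (n + 1) =
      history X Y n ⁻¹' plusPhase n ∩ {ω | Y (n + 1) ω = false} ∪
        history X Y n ⁻¹' minusPhase n ∩ {ω | Y (n + 1) ω = false} := by
  ext ω
  rw [mem_minusPhase, ← Set.union_inter_distrib_right, Set.mem_inter_iff, Set.mem_union,
    mem_plusPhase, mem_minusPhase, Set.mem_ofPred_eq, and_comm]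
  refine and_congr_left fun hn => ⟨fun h => ?_, ?_⟩
  · rcases hY : Y n ω with _ | _
    · exact .inr ⟨rfl, fun j k hjk hk => h j k hjk (by lia)⟩
    · refine .inl fun k hk => ?_
      rcases hk.eq_or_lt with rfl | hk
      · exact hY
      · by_contra hkn
        have := h k n hk (by lia) (by simpa using hkn)
        simp [this] at hY
  · rintro (h | h) j k hjk hk hj
    · simp [h j (by lia)] at hj
    · rcases hk.eq_or_lt with rfl | hk
      · exact hn
      · exact h.2 j k hjk (by lia) hj

theorem T1_eq_of_mem [MeasurableSpace Ω] (X : ℕ → Ω → ℤ) {n : ℕ} {ω : Ω}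
    (h : ω ∈ history X Y n ⁻¹' minusPhase n) (hn : Y (n + 1) ω = true) : T1 Y ω = n + 1 := by
  rw [mem_minusPhase] at h
  refine IsLeast.csInf_eq ⟨⟨by lia, hn, n, by lia, h.1⟩, ?_⟩
  rintro k ⟨-, hk, m, hm, hmY⟩
  by_contra! hkn
  simp [h.2 m k hm (by lia) hmY] at hk

end Paths

section Chain

variable {Ω : Type*} [MeasurableSpace Ω] {μ : Measure Ω} {A B C : ℝ}
  {X : ℕ → Ω → ℤ} {Y : ℕ → Ω → Bool}

theorem IsDBDChain.measurable_history (h : IsDBDChain μ A B C X Y) (n : ℕ) :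
    Measurable (history X Y n) :=
  measurable_pi_lambda _ fun k => (h.1 k).prodMk (h.2.1 k)

theorem IsDBDChain.measurableSet_eq (h : IsDBDChain μ A B C X Y) (n : ℕ) (z : ℤ × Bool) :
    MeasurableSet {ω | (X n ω, Y n ω) = z} :=
  ((h.1 n).prodMk (h.2.1 n)) (measurableSet_singleton z)

/-- The law of `X n` on the event `E`. -/
noncomputable def lawOn (μ : Measure Ω) (X : ℕ → Ω → ℤ) (n : ℕ) (E : Set Ω) : Measure ℤ :=
  (μ.restrict E).map (X n)

theorem IsDBDChain.lawOn_singleton (h : IsDBDChain μ A B C X Y) (n : ℕ) (E : Set Ω) (i : ℤ) :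
    lawOn μ X n E {i} = μ (E ∩ {ω | X n ω = i}) := by
  rw [lawOn, Measure.map_apply (h.1 n) (measurableSet_singleton i),
    Measure.restrict_apply (h.1 n (measurableSet_singleton i)), Set.inter_comm]
  rfl

theorem dbdStep_nonneg (hA : 0 ≤ A) (hB : 0 ≤ B) (hC : 0 ≤ C) (z w : ℤ × Bool) :
    0 ≤ dbdStep A B C z w := by
  rcases z with ⟨i, _ | _⟩ <;> rcases w with ⟨j, _ | _⟩ <;> simp only [dbdStep] <;>
    split_ifs <;> first | assumption | exact le_rfl

variable [IsProbabilityMeasure μ]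

theorem IsDBDChain.measure_path_succ (h : IsDBDChain μ A B C X Y) (hA : 0 ≤ A) (hB : 0 ≤ B)
    (hC : 0 ≤ C) (n : ℕ) (s : ℕ → ℤ × Bool) :
    μ {ω | ∀ k ≤ n + 1, (X k ω, Y k ω) = s k} =
      ENNReal.ofReal (dbdStep A B C (s n) (s (n + 1))) *
        μ {ω | ∀ k ≤ n, (X k ω, Y k ω) = s k} := by
  rw [← ENNReal.toReal_eq_toReal_iff' (measure_ne_top _ _)
    (ENNReal.mul_ne_top ENNReal.ofReal_ne_top (measure_ne_top _ _)), ENNReal.toReal_mul,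
    ENNReal.toReal_ofReal (dbdStep_nonneg hA hB hC _ _), h.2.2, h.2.2, Finset.prod_range_succ]
  ring

/-- The Markov property at time `n`. -/
theorem IsDBDChain.measure_history_inter (h : IsDBDChain μ A B C X Y) (hA : 0 ≤ A) (hB : 0 ≤ B)
    (hC : 0 ≤ C) (n : ℕ) (S : Set (Fin (n + 1) → ℤ × Bool)) (z w : ℤ × Bool) :
    μ (history X Y n ⁻¹' S ∩ {ω | (X n ω, Y n ω) = z ∧ (X (n + 1) ω, Y (n + 1) ω) = w}) =
      ENNReal.ofReal (dbdStep A B C z w) *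
        μ (history X Y n ⁻¹' S ∩ {ω | (X n ω, Y n ω) = z}) := by
  have hH := h.measurable_history n
  suffices hm : (μ.restrict {ω | (X n ω, Y n ω) = z ∧ (X (n + 1) ω, Y (n + 1) ω) = w}).map
      (history X Y n) = ENNReal.ofReal (dbdStep A B C z w) •
        (μ.restrict {ω | (X n ω, Y n ω) = z}).map (history X Y n) by
    have hS : MeasurableSet S := S.to_countable.measurableSet
    have := congrArg (fun ρ => ρ S) hm
    simpa [Measure.map_apply hH hS, Measure.restrict_apply (hH hS)] using this
  refine Measure.ext_of_singleton fun p => ?_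
  have hp := measurableSet_singleton p
  rw [Measure.smul_apply, Measure.map_apply hH hp, Measure.map_apply hH hp,
    Measure.restrict_apply (hH hp), Measure.restrict_apply (hH hp), smul_eq_mul]
  by_cases hz : p (Fin.last n) = z
  · have hpath := h.measure_path_succ hA hB hC n
      fun k => if hk : k < n + 1 then p ⟨k, hk⟩ else w
    have hlast : p ⟨n, n.lt_succ_self⟩ = z := hz
    simp only [Nat.lt_succ_self, dite_true, lt_irrefl, dite_false, hlast] at hpath
    have hhist : ∀ ω, (∀ k ≤ n, (X k ω, Y k ω) = if hk : k < n + 1 then p ⟨k, hk⟩ else w) ↔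
        history X Y n ω = p := by
      refine fun ω => ⟨fun H => funext fun k => ?_, fun H k hk => ?_⟩
      · exact (H k (Nat.lt_succ_iff.1 k.2)).trans (dif_pos k.2)
      · rw [dif_pos (Nat.lt_succ_iff.2 hk), ← H]
        rfl
    have hn : ∀ ω, history X Y n ω = p → (X n ω, Y n ω) = z := fun ω H => by
      rw [← hz, ← H]
      rfl
    convert hpath using 2
    · ext ω
      simp only [Set.mem_inter_iff, Set.mem_preimage, Set.mem_singleton_iff, Set.mem_ofPred_eq,
        Nat.le_add_one_iff, or_imp, forall_and, forall_eq, hhist, lt_irrefl, dite_false]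
      exact ⟨fun H => ⟨H.1, H.2.2⟩, fun H => ⟨H.1, hn ω H.1, H.2⟩⟩
    · congr 1
      ext ω
      simp only [Set.mem_inter_iff, Set.mem_preimage, Set.mem_singleton_iff, Set.mem_ofPred_eq,
        hhist]
      exact ⟨fun H => H.1, fun H => ⟨H, hn ω H⟩⟩
  · have hn : ∀ ω, history X Y n ω = p → (X n ω, Y n ω) ≠ z := fun ω H H' => by
      rw [← H] at hz
      exact hz H'
    have e1 : history X Y n ⁻¹' {p} ∩
        {ω | (X n ω, Y n ω) = z ∧ (X (n + 1) ω, Y (n + 1) ω) = w} = ∅ :=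
      Set.eq_empty_of_forall_notMem fun ω H => hn ω H.1 H.2.1
    have e2 : history X Y n ⁻¹' {p} ∩ {ω | (X n ω, Y n ω) = z} = ∅ :=
      Set.eq_empty_of_forall_notMem fun ω H => hn ω H.1 H.2
    rw [e1, e2, measure_empty, mul_zero]

theorem IsDBDChain.lawOn_succ_singleton (h : IsDBDChain μ A B C X Y) (hA : 0 ≤ A) (hB : 0 ≤ B)
    (hC : 0 ≤ C) (n : ℕ) (S : Set (Fin (n + 1) → ℤ × Bool)) (y y' : Bool)
    (hy : ∀ ω ∈ history X Y n ⁻¹' S, Y n ω = y) (i : ℤ) :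
    lawOn μ X (n + 1) (history X Y n ⁻¹' S ∩ {ω | Y (n + 1) ω = y'}) {i} =
      ∑' j, ENNReal.ofReal (dbdStep A B C (j, y) (i, y')) *
        lawOn μ X n (history X Y n ⁻¹' S) {j} := by
  have hS : MeasurableSet (history X Y n ⁻¹' S) :=
    h.measurable_history n S.to_countable.measurableSet
  have key : ∀ j, ENNReal.ofReal (dbdStep A B C (j, y) (i, y')) *
        lawOn μ X n (history X Y n ⁻¹' S) {j} =
      μ (history X Y n ⁻¹' S ∩
        {ω | (X n ω, Y n ω) = (j, y) ∧ (X (n + 1) ω, Y (n + 1) ω) = (i, y')}) := fun j => by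
    rw [h.measure_history_inter hA hB hC, h.lawOn_singleton]
    congr 2
    ext ω
    simp only [Set.mem_inter_iff, Set.mem_ofPred_eq, Prod.mk.injEq, and_congr_right_iff]
    exact fun H => (and_iff_left (hy ω H)).symm
  rw [tsum_congr key, h.lawOn_singleton, ← measure_iUnion]
  · congr 1
    ext ω
    simp only [Set.mem_inter_iff, Set.mem_ofPred_eq, Prod.mk.injEq, Set.mem_iUnion]
    exact ⟨fun H => ⟨X n ω, H.1.1, ⟨rfl, hy ω H.1.1⟩, H.2, H.1.2⟩,
      fun ⟨_, H1, _, H2, H3⟩ => ⟨⟨H1, H3⟩, H2⟩⟩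
  · intro j j' hjj'
    refine Set.disjoint_left.2 fun ω H H' => hjj' ?_
    have := H.2.1.symm.trans H'.2.1
    simpa using this
  · exact fun j => hS.inter ((h.measurableSet_eq n _).inter (h.measurableSet_eq (n + 1) _))

theorem IsDBDChain.lawOn_stay_true (h : IsDBDChain μ A B C X Y) (hA : 0 ≤ A) (hB : 0 ≤ B)
    (hC : 0 ≤ C) (n : ℕ) (S : Set (Fin (n + 1) → ℤ × Bool))
    (hy : ∀ ω ∈ history X Y n ⁻¹' S, Y n ω = true) :
    lawOn μ X (n + 1) (history X Y n ⁻¹' S ∩ {ω | Y (n + 1) ω = true}) =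
      walkStep A B (lawOn μ X n (history X Y n ⁻¹' S)) := by
  refine Measure.ext_of_singleton fun i => ?_
  rw [h.lawOn_succ_singleton hA hB hC n S true true hy, walkStep_singleton,
    tsum_eq_sum (s := {i - 1, i + 1}), Finset.sum_pair (by lia)]
  · have h1 : i ≠ i + 1 + 1 := by lia
    simp [dbdStep, h1]
  · intro j hj
    simp only [Finset.mem_insert, Finset.mem_singleton, not_or] at hj
    have h1 : i ≠ j + 1 := by lia
    have h2 : i ≠ j - 1 := by lia
    simp [dbdStep, h1, h2]

theorem IsDBDChain.lawOn_stay_false (h : IsDBDChain μ A B C X Y) (hA : 0 ≤ A) (hB : 0 ≤ B)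
    (hC : 0 ≤ C) (n : ℕ) (S : Set (Fin (n + 1) → ℤ × Bool))
    (hy : ∀ ω ∈ history X Y n ⁻¹' S, Y n ω = false) :
    lawOn μ X (n + 1) (history X Y n ⁻¹' S ∩ {ω | Y (n + 1) ω = false}) =
      walkStep B A (lawOn μ X n (history X Y n ⁻¹' S)) := by
  refine Measure.ext_of_singleton fun i => ?_
  rw [h.lawOn_succ_singleton hA hB hC n S false false hy, walkStep_singleton,
    tsum_eq_sum (s := {i - 1, i + 1}), Finset.sum_pair (by lia)]
  · have h1 : i ≠ i - 1 - 1 := by lia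
    simp [dbdStep, h1]
  · intro j hj
    simp only [Finset.mem_insert, Finset.mem_singleton, not_or] at hj
    have h1 : i ≠ j + 1 := by lia
    have h2 : i ≠ j - 1 := by lia
    simp [dbdStep, h1, h2]

theorem IsDBDChain.lawOn_switch (h : IsDBDChain μ A B C X Y) (hA : 0 ≤ A) (hB : 0 ≤ B)
    (hC : 0 ≤ C) (n : ℕ) (S : Set (Fin (n + 1) → ℤ × Bool)) (y y' : Bool) (hyy' : y' = !y)
    (hy : ∀ ω ∈ history X Y n ⁻¹' S, Y n ω = y) :
    lawOn μ X (n + 1) (history X Y n ⁻¹' S ∩ {ω | Y (n + 1) ω = y'}) =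
      ENNReal.ofReal C • lawOn μ X n (history X Y n ⁻¹' S) := by
  subst hyy'
  refine Measure.ext_of_singleton fun i => ?_
  rw [h.lawOn_succ_singleton hA hB hC n S y (!y) hy, tsum_eq_single i]
  · cases y <;> simp [dbdStep]
  · intro j hj
    cases y <;> simp [dbdStep, hj.symm]

/-- Moments of `X n` while the chain has not left the `+` row. -/
def plusMoments (A B : ℝ) : ℕ → ℝ × ℝ × ℝ
  | 0 => (1, 0, 0)
  | n + 1 => momentStep A B (plusMoments A B n)

/-- Moments of `X n` during the first visit of the chain to the `-` row. -/
def minusMoments (A B C : ℝ) : ℕ → ℝ × ℝ × ℝ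
  | 0 => (0, 0, 0)
  | n + 1 => C • plusMoments A B n + momentStep B A (minusMoments A B C n)

theorem IsDBDChain.measure_start (h : IsDBDChain μ A B C X Y) (z : ℤ × Bool) :
    μ {ω | (X 0 ω, Y 0 ω) = z} = if z = (0, true) then 1 else 0 := by
  have := h.2.2 0 fun _ => z
  simp only [Nat.le_zero, forall_eq, Finset.range_zero, Finset.prod_empty, mul_one] at this
  rw [← ENNReal.toReal_eq_toReal_iff' (measure_ne_top _ _) (by split_ifs <;> simp), this]
  split_ifs <;> simp

theorem IsDBDChain.hasMoments_plusPhase (h : IsDBDChain μ A B C X Y) (hA : 0 ≤ A) (hB : 0 ≤ B)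
    (hC : 0 ≤ C) (n : ℕ) :
    HasMoments (lawOn μ X n (history X Y n ⁻¹' plusPhase n)) (plusMoments A B n) := by
  induction n with
  | zero =>
    have : lawOn μ X 0 (history X Y 0 ⁻¹' plusPhase 0) = Measure.dirac 0 := by
      refine Measure.ext_of_singleton fun i => ?_
      have hs : history X Y 0 ⁻¹' plusPhase 0 ∩ {ω | X 0 ω = i} =
          {ω | (X 0 ω, Y 0 ω) = (i, true)} := by
        ext ω
        rw [Set.mem_inter_iff, mem_plusPhase]
        simp [and_comm]
      rw [h.lawOn_singleton, hs, h.measure_start]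
      simp [Set.indicator_apply, eq_comm]
    rw [this]
    exact .dirac_zero
  | succ n ih =>
    rw [plusPhase_succ, h.lawOn_stay_true hA hB hC n _ fun ω hω => mem_plusPhase.1 hω n le_rfl]
    exact ih.walkStep hA hB

theorem IsDBDChain.hasMoments_minusPhase (h : IsDBDChain μ A B C X Y) (hA : 0 ≤ A) (hB : 0 ≤ B)
    (hC : 0 ≤ C) (n : ℕ) :
    HasMoments (lawOn μ X n (history X Y n ⁻¹' minusPhase n)) (minusMoments A B C n) := by
  induction n with
  | zero =>
    have : lawOn μ X 0 (history X Y 0 ⁻¹' minusPhase 0) = 0 := by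
      refine Measure.ext_of_singleton fun i => ?_
      have hs : history X Y 0 ⁻¹' minusPhase 0 ∩ {ω | X 0 ω = i} ⊆
          {ω | (X 0 ω, Y 0 ω) = (i, false)} := fun ω hω => Prod.ext hω.2 (mem_minusPhase.1 hω.1).1
      rw [h.lawOn_singleton]
      exact measure_mono_null hs ((h.measure_start _).trans (by simp))
    rw [this]
    exact .zero
  | succ n ih =>
    have hplus : ∀ ω ∈ history X Y n ⁻¹' plusPhase n, Y n ω = true :=
      fun ω hω => mem_plusPhase.1 hω n le_rfl
    have hminus : ∀ ω ∈ history X Y n ⁻¹' minusPhase n, Y n ω = false :=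
      fun ω hω => (mem_minusPhase.1 hω).1
    have hdisj : Disjoint (history X Y n ⁻¹' plusPhase n ∩ {ω | Y (n + 1) ω = false})
        (history X Y n ⁻¹' minusPhase n ∩ {ω | Y (n + 1) ω = false}) :=
      Set.disjoint_left.2 fun ω h1 h2 => by simpa [hplus ω h1.1] using hminus ω h2.1
    have hmeas : MeasurableSet (history X Y n ⁻¹' minusPhase n ∩ {ω | Y (n + 1) ω = false}) :=
      (h.measurable_history n (minusPhase n).to_countable.measurableSet).inter
        (h.2.1 (n + 1) (measurableSet_singleton false))
    rw [minusPhase_succ, lawOn, Measure.restrict_union hdisj hmeas,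
      Measure.map_add _ _ (h.1 (n + 1))]
    refine HasMoments.add ?_ ?_
    · rw [← lawOn, h.lawOn_switch hA hB hC n _ true false rfl hplus]
      exact (h.hasMoments_plusPhase hA hB hC n).smul hC
    · rw [← lawOn, h.lawOn_stay_false hA hB hC n _ hminus]
      exact ih.walkStep hB hA

end Chain

/-- Var(X_{T₁}) = 2 (A−B)²/C² + 2 (1−C)/C. -/
theorem variance_of_regeneration_displacement
    (A B C : ℝ) (hA : 0 ≤ A) (hB : 0 ≤ B) (hC : 0 < C) (hsum : A + B + C = 1)
    {Ω : Type*} [MeasurableSpace Ω] (μ : Measure Ω) [IsProbabilityMeasure μ]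
    (X : ℕ → Ω → ℤ) (Y : ℕ → Ω → Bool)
    (hchain : IsDBDChain μ A B C X Y) :
    variance (fun ω => ((X (T1 Y ω) ω : ℤ) : ℝ)) μ =
      2 * ((A - B) ^ 2 / C ^ 2) + 2 * ((1 - C) / C) := by
  have hC1 : C ≤ 1 := by linarith
  have hAB : A + B = 1 - C := by linarith
  have hBA : B + A = 1 - C := by linarith
  set f : Ω → ℝ := fun ω => ((X (T1 Y ω) ω : ℤ) : ℝ) with hf
  set R : ℕ → Set Ω := fun n =>
    history X Y n ⁻¹' minusPhase n ∩ {ω | Y (n + 1) ω = true} with hR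
  set a := plusMoments A B with ha
  set b := minusMoments A B C with hb
  have hRmeas : ∀ n, MeasurableSet (R n) := fun n =>
    (hchain.measurable_history n (minusPhase n).to_countable.measurableSet).inter
      (hchain.2.1 (n + 1) (measurableSet_singleton true))
  have hRT : ∀ n, ∀ ω ∈ R n, T1 Y ω = n + 1 := fun n ω hω => T1_eq_of_mem X hω.1 hω.2
  have hRdisj : Pairwise (Function.onFun Disjoint R) := fun m n hmn =>
    Set.disjoint_left.2 fun ω hm hn => hmn (by
      have := (hRT m ω hm).symm.trans (hRT n ω hn)
      lia)
  have hmom : ∀ n, HasMoments (lawOn μ X (n + 1) (R n)) (C • b n) := fun n => by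
    simp only [hR]
    rw [hchain.lawOn_switch hA hB hC.le n _ false true rfl fun ω h => (mem_minusPhase.1 h).1]
    exact (hchain.hasMoments_minusPhase hA hB hC.le n).smul hC.le
  have hint : ∀ (g : ℝ → ℝ) (n : ℕ), ∫ ω in R n, g (f ω) ∂μ =
      ∫ x : ℤ, g x ∂lawOn μ X (n + 1) (R n) := fun g n => by
    rw [lawOn, integral_map (hchain.1 _).aemeasurable
      (Measurable.of_discrete (f := fun x : ℤ => g x)).aestronglyMeasurable]
    refine setIntegral_congr_fun (hRmeas n) fun ω hω => ?_
    simp only [hf, hRT n ω hω]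
  -- Sums of the truncated moments.
  have a0 : HasSum (fun n => (a n).1) (1 / C) := by
    simpa [ha, plusMoments] using hasSum_of_linear_recursion hC hC1 (x := fun n => (a n).1)
      (fun n => by simp [ha, plusMoments, momentStep, hAB]) hasSum_zero
  have a1 : HasSum (fun n => (a n).2.1) ((A - B) * (1 / C) / C) := by
    simpa [ha, plusMoments] using hasSum_of_linear_recursion hC hC1 (x := fun n => (a n).2.1)
      (fun n => by simp [ha, plusMoments, momentStep, hAB]) (a0.mul_left (A - B))
  have a2 : HasSum (fun n => (a n).2.2)
      ((2 * (A - B) * ((A - B) * (1 / C) / C) + (1 - C) * (1 / C)) / C) := by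
    simpa [ha, plusMoments] using hasSum_of_linear_recursion hC hC1 (x := fun n => (a n).2.2)
      (fun n => by simp [ha, plusMoments, momentStep, hAB])
      ((a1.mul_left (2 * (A - B))).add (a0.mul_left (1 - C)))
  have b0 : HasSum (fun n => (b n).1) (1 / C) := by
    have := hasSum_of_linear_recursion hC hC1 (x := fun n => (b n).1)
      (fun n => by simp [hb, minusMoments, momentStep, hBA, ha, add_comm]) (a0.mul_left C)
    convert this using 1
    simp [hb, minusMoments, hC.ne']
  have b1 : HasSum (fun n => (b n).2.1) 0 := by
    have := hasSum_of_linear_recursion hC hC1 (x := fun n => (b n).2.1)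
      (fun n => by simp only [hb, minusMoments, momentStep, hBA, ha, Prod.fst_add, Prod.snd_add,
        Prod.smul_fst, Prod.smul_snd, smul_eq_mul]; ring)
      ((a1.mul_left C).add (b0.mul_left (B - A)))
    convert this using 1
    simp only [hb, minusMoments]
    field_simp
    ring
  have b2 : HasSum (fun n => (b n).2.2)
      ((2 * ((A - B) ^ 2 / C ^ 2) + 2 * ((1 - C) / C)) / C) := by
    have := hasSum_of_linear_recursion hC hC1 (x := fun n => (b n).2.2)
      (fun n => by simp only [hb, minusMoments, momentStep, hBA, ha, Prod.snd_add,
        Prod.smul_snd, smul_eq_mul]; ring)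
      ((a2.mul_left C).add ((b1.mul_left (2 * (B - A))).add (b0.mul_left (1 - C))))
    convert this using 1
    simp only [hb, minusMoments]
    field_simp
    ring
  -- Regeneration happens almost surely.
  have hfull : μ (⋃ n, R n) = 1 := by
    have h1 := hasSum_integral_iUnion (f := fun _ => (1 : ℝ)) hRmeas hRdisj
      (integrable_const (μ := μ) 1).integrableOn
    have h2 : HasSum (fun n => ∫ _ω in R n, (1 : ℝ) ∂μ) 1 := by
      have h3 : ∀ n, ∫ _ω in R n, (1 : ℝ) ∂μ = C * (b n).1 := fun n =>
        (hint (fun _ => 1) n).trans (hmom n).integral_one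
      simp only [h3]
      simpa [hC.ne'] using b0.mul_left C
    have h4 := h1.unique h2
    rw [setIntegral_const, smul_eq_mul, mul_one, measureReal_def] at h4
    rw [← ENNReal.toReal_eq_one_iff]
    exact h4
  have hrestrict : μ.restrict (⋃ n, R n) = μ :=
    Measure.restrict_eq_self_of_ae_mem
      ((prob_compl_eq_zero_iff (MeasurableSet.iUnion hRmeas)).2 hfull)
  have hsq : ∀ n, ∫ ω in R n, f ω ^ 2 ∂μ = C * (b n).2.2 := fun n =>
    (hint (fun x => x ^ 2) n).trans (hmom n).integral_sq
  have hae : ∀ n, f =ᵐ[μ.restrict (R n)] fun ω => (X (n + 1) ω : ℝ) := fun n =>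
    (ae_restrict_iff' (hRmeas n)).2 (ae_of_all _ fun ω hω => by simp only [hf, hRT n ω hω])
  have hmeas : AEStronglyMeasurable f μ := by
    rw [← hrestrict]
    refine AEStronglyMeasurable.iUnion fun n => ?_
    exact ((Measurable.of_discrete (f := fun x : ℤ => (x : ℝ))).comp
      (hchain.1 (n + 1))).aestronglyMeasurable.congr (hae n).symm
  have hsqint : Integrable (fun ω => f ω ^ 2) μ := by
    rw [← hrestrict]
    refine integrableOn_iUnion_of_summable_integral_norm (fun n => ?_) ?_
    · refine ((integrable_map_measure ?_ (hchain.1 _).aemeasurable).1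
        (hmom n).integrable_sq).congr ?_
      · exact (Measurable.of_discrete (f := fun x : ℤ => (x : ℝ) ^ 2)).aestronglyMeasurable
      · filter_upwards [hae n] with ω hω
        simp [hω]
    · simp only [norm_pow, Real.norm_eq_abs, sq_abs, hsq]
      exact (b2.mul_left C).summable
  have hLp : MemLp f 2 μ := (memLp_two_iff_integrable_sq hmeas).2 hsqint
  have hmean : ∫ ω, f ω ∂μ = 0 := by
    have h1 := hasSum_integral_iUnion hRmeas hRdisj
      (hLp.integrable one_le_two).integrableOn
    rw [hrestrict] at h1
    refine h1.unique ?_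
    have h3 : ∀ n, ∫ ω in R n, f ω ∂μ = C * (b n).2.1 := fun n =>
      (hint (fun x => x) n).trans (hmom n).integral_id
    simp only [h3]
    simpa using b1.mul_left C
  have hsecond : ∫ ω, f ω ^ 2 ∂μ = 2 * ((A - B) ^ 2 / C ^ 2) + 2 * ((1 - C) / C) := by
    have h1 := hasSum_integral_iUnion hRmeas hRdisj hsqint.integrableOn
    rw [hrestrict] at h1
    refine h1.unique ?_
    simp only [hsq]
    simpa only [mul_div_cancel₀ _ hC.ne'] using b2.mul_left C
  rw [variance_eq_sub hLp, hmean]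
  simpa using hsecond
end
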